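/- Let 𝒰 = (U_a)_{a∈𝔸} be a continuous unitary representation of a locally compact second countable Abelian group 𝔸 on a separable Hilbert space H. Suppose H = ⊕_{i=1}^∞ 𝔸(x_i) and H = ⊕_{i=1}^∞ 𝔸(x'_i) are two spectral decompositions of H, i.e. orthogonal decompositions into cyclic subspaces with σ_{x_1} ≫ σ_{x_2} ≫ … and σ_{x'_1} ≫ σ_{x'_2} ≫ …. Then σ_{x_i} and σ_{x'_i} are equivalent measures (mutually absolutely continuous) for every i ≥ 1. (Spectral Theorem: uniqueness of the spectral decomposition) -/

import Mathlib

open MeasureTheory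

variable {A : Type*} [CommGroup A] [TopologicalSpace A] [IsTopologicalGroup A]
  [LocallyCompactSpace A] [SecondCountableTopology A]
  [MeasurableSpace (PontryaginDual A)] [BorelSpace (PontryaginDual A)]
  {H : Type*} [NormedAddCommGroup H] [InnerProductSpace ℂ H] [CompleteSpace H]

/-- The cyclic space `A(x)` generated by a vector `x` under a unitary representation `U`:
the closed linear span of `{U_a x : a ∈ A}` (we record the span; closures are taken where
needed). -/
def cyclicSpace (U : A →* (H ≃ₗᵢ[ℂ] H)) (x : H) : Submodule ℂ H :=
  Submodule.span ℂ (Set.range fun a : A => U a x)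

/-- `σ` is the spectral measure of the vector `x` for the unitary representation `U`:
`⟨U_a x, x⟩ = ∫_Â χ(a) dσ(χ)` for all `a ∈ A` (Bochner–Herglotz). -/
def IsSpectralMeasure (U : A →* (H ≃ₗᵢ[ℂ] H)) (x : H)
    (σ : Measure (PontryaginDual A)) : Prop :=
  ∀ a : A, (inner ℂ (U a x) x : ℂ) = ∫ χ : PontryaginDual A, (χ a : ℂ) ∂σ

/-- A spectral decomposition of `H` for the representation `U`: an orthogonal decomposition
`H = ⊕_{i} A(xᵢ)` into cyclic subspaces whose spectral measures form a decreasing chain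
`σ_{x₁} ≫ σ_{x₂} ≫ ⋯`. -/
structure IsSpectralDecomposition (U : A →* (H ≃ₗᵢ[ℂ] H))
    (x : ℕ → H) (σ : ℕ → Measure (PontryaginDual A)) : Prop where
  spectral : ∀ i, IsSpectralMeasure U (x i) (σ i)
  finite : ∀ i, IsFiniteMeasure (σ i)
  chain : ∀ i, σ (i + 1) ≪ σ i
  orthogonal : ∀ i j, i ≠ j → ∀ v ∈ cyclicSpace U (x i), ∀ w ∈ cyclicSpace U (x j),
    (inner ℂ v w : ℂ) = 0
  total : (⨆ i, cyclicSpace U (x i)).topologicalClosure = ⊤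

set_option linter.unusedSectionVars false

open scoped ENNReal ComplexConjugate InnerProductSpace BoundedContinuousFunction

namespace PontryaginDual

theorem polishSpace : PolishSpace (PontryaginDual A) := by
  have h : Topology.IsClosedEmbedding
      (ContinuousMonoidHom.toContinuousMap : (A →ₜ* Circle) → C(A, Circle)) :=
    ContinuousMonoidHom.isClosedEmbedding_toContinuousMap A Circle
  have : (uniformity Circle).IsCountablyGenerated :=
    inferInstanceAs (uniformity (Metric.sphere (0 : ℂ) 1)).IsCountablyGenerated
  have : CompleteSpace C(A, Circle) := inferInstance
  have : PolishSpace C(A, Circle) := inferInstance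
  exact h.polishSpace

theorem continuous_eval (a : A) : Continuous fun χ : PontryaginDual A => (χ a : ℂ) := by
  have h : Continuous fun χ : A →ₜ* Circle => χ a :=
    (continuous_eval_const (F := C(A, Circle)) a).comp
      (ContinuousMonoidHom.isEmbedding_toContinuousMap A Circle).continuous
  exact continuous_subtype_val.comp h

/-- Evaluation at a point of the group, as a homomorphism into the bounded continuous functions
on the dual group. -/
noncomputable def evalHom : A →* (PontryaginDual A →ᵇ ℂ) where
  toFun a := BoundedContinuousFunction.ofNormedAddCommGroup (fun χ => (χ a : ℂ))
    (continuous_eval a) 1 (fun χ => (Circle.norm_coe _).le)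
  map_one' := by ext; simp
  map_mul' a b := by ext; simp

theorem evalHom_inv (a : A) (χ : PontryaginDual A) :
    evalHom a⁻¹ χ = conj (evalHom a χ) := by
  change ((χ a⁻¹ : Circle) : ℂ) = conj ((χ a : Circle) : ℂ)
  rw [map_inv, Circle.coe_inv_eq_conj]

theorem norm_evalHom (a : A) (χ : PontryaginDual A) : ‖evalHom a χ‖ = 1 :=
  Circle.norm_coe _

/-- Finite measures on the dual group are determined by their Fourier transforms. -/
theorem measure_ext {μ ν : Measure (PontryaginDual A)} [IsFiniteMeasure μ] [IsFiniteMeasure ν]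
    (h : ∀ a : A, ∫ χ, evalHom a χ ∂μ = ∫ χ, evalHom a χ ∂ν) : μ = ν := by
  have := polishSpace (A := A)
  set e : A →* (PontryaginDual A →ᵇ ℂ) := evalHom
  refine ext_of_forall_mem_subalgebra_integral_eq_of_polish (𝕜 := ℂ)
    (A := StarAlgebra.adjoin ℂ (Set.range e)) ?_ ?_
  · intro χ ψ hne
    obtain ⟨a, ha⟩ : ∃ a, χ a ≠ ψ a := by
      by_contra! hall
      exact hne (PontryaginDual.ext hall)
    exact ⟨fun χ => (χ a : ℂ), ⟨⟨_, continuous_eval a⟩, ⟨e a,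
      StarAlgebra.subset_adjoin ℂ _ ⟨a, rfl⟩, rfl⟩, rfl⟩, fun hc => ha (Circle.coe_injective hc)⟩
  · have hstar : star (Set.range e) ⊆ Set.range e := by
      rintro g ⟨a, ha⟩
      refine ⟨a⁻¹, ?_⟩
      rw [← star_star g, ← ha]
      ext χ
      exact evalHom_inv a χ
    intro g hg
    have hspan : g ∈ Submodule.span ℂ (Set.range e) := by
      rw [← StarSubalgebra.mem_toSubalgebra, StarAlgebra.adjoin_toSubalgebra,
        Set.union_eq_self_of_subset_right hstar, ← Subalgebra.mem_toSubmodule,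
        Algebra.adjoin_eq_span, ← MonoidHom.coe_mrange, Submonoid.closure_eq] at hg
      exact hg
    clear hg
    induction hspan using Submodule.span_induction with
    | mem g hg => obtain ⟨a, rfl⟩ := hg; exact h a
    | zero => simp
    | add f g _ _ hf hg =>
      simp only [BoundedContinuousFunction.coe_add, Pi.add_apply]
      rw [integral_add (f.integrable μ) (g.integrable μ),
        integral_add (f.integrable ν) (g.integrable ν), hf, hg]
    | smul c g _ hg => simp only [BoundedContinuousFunction.coe_smul, integral_smul, hg]

theorem integrable_eval_mul {μ : Measure (PontryaginDual A)} {F : PontryaginDual A → ℂ}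
    (hF : Integrable F μ) (a : A) : Integrable (fun χ => evalHom a χ * F χ) μ :=
  hF.bdd_mul (c := 1) (evalHom a).continuous.aestronglyMeasurable
    (.of_forall fun _ => (norm_evalHom a _).le)

/-- Real densities with the same Fourier transform have the same integrals over every measurable
set. -/
theorem setIntegral_eq_of_integral_eval_ofReal_mul_eq {μ ν : Measure (PontryaginDual A)}
    {F G : PontryaginDual A → ℝ} (hF : Integrable F μ) (hG : Integrable G ν)
    (h : ∀ a : A, ∫ χ, evalHom a χ * (F χ : ℂ) ∂μ = ∫ χ, evalHom a χ * (G χ : ℂ) ∂ν)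
    {B : Set (PontryaginDual A)} (hB : MeasurableSet B) :
    ∫ χ in B, F χ ∂μ = ∫ χ in B, G χ ∂ν := by
  have hfin (μ : Measure (PontryaginDual A)) (F : PontryaginDual A → ℝ) (hF : Integrable F μ) :
      IsFiniteMeasure (μ.withDensity fun χ => ENNReal.ofReal (F χ)) :=
    isFiniteMeasure_withDensity_ofReal hF.2
  have f1 := hfin μ F hF
  have f2 := hfin μ _ hF.neg
  have f3 := hfin ν G hG
  have f4 := hfin ν _ hG.neg
  have split (μ : Measure (PontryaginDual A)) (F : PontryaginDual A → ℝ) (hF : Integrable F μ)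
      (a : A) : ∫ χ, evalHom a χ * (F χ : ℂ) ∂μ =
      (∫ χ, evalHom a χ ∂(μ.withDensity fun χ => ENNReal.ofReal (F χ))) -
      (∫ χ, evalHom a χ ∂(μ.withDensity fun χ => ENNReal.ofReal ((-F) χ))) := by
    have hpos (F : PontryaginDual A → ℝ) (hF : Integrable F μ) :
        ∫ χ, evalHom a χ ∂(μ.withDensity fun χ => ENNReal.ofReal (F χ)) =
          ∫ χ, evalHom a χ * ((max (F χ) 0 : ℝ) : ℂ) ∂μ := by
      rw [integral_withDensity_eq_integral_toReal_smul₀ hF.1.aemeasurable.ennreal_ofReal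
        (.of_forall fun _ => ENNReal.ofReal_lt_top)]
      refine integral_congr_ae (.of_forall fun χ => ?_)
      simp [ENNReal.toReal_ofReal', mul_comm]
    rw [hpos F hF, hpos _ hF.neg, ← integral_sub
      (integrable_eval_mul (F := fun χ => ((max (F χ) 0 : ℝ) : ℂ)) hF.pos_part.ofReal a)
      (integrable_eval_mul (F := fun χ => ((max ((-F) χ) 0 : ℝ) : ℂ)) hF.neg.pos_part.ofReal a)]
    refine integral_congr_ae (.of_forall fun χ => ?_)
    simp only [Pi.neg_apply, ← mul_sub, ← Complex.ofReal_sub]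
    congr 2
    rcases le_total (F χ) 0 with h0 | h0 <;> simp [h0]
  have hm : (μ.withDensity fun χ => ENNReal.ofReal (F χ)) +
      (ν.withDensity fun χ => ENNReal.ofReal ((-G) χ)) =
      (μ.withDensity fun χ => ENNReal.ofReal ((-F) χ)) +
      (ν.withDensity fun χ => ENNReal.ofReal (G χ)) := by
    refine measure_ext fun a => ?_
    have hi (μ : Measure (PontryaginDual A)) [IsFiniteMeasure μ] :
        Integrable (fun χ => evalHom a χ) μ := (evalHom a).integrable μ
    rw [integral_add_measure (hi _) (hi _), integral_add_measure (hi _) (hi _)]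
    have := h a
    rw [split μ F hF, split ν G hG] at this
    linear_combination this
  have hv (μ : Measure (PontryaginDual A)) (F : PontryaginDual A → ℝ) (hF : Integrable F μ) :
      ∫ χ in B, F χ ∂μ = (μ.withDensity fun χ => ENNReal.ofReal (F χ)).real B -
        (μ.withDensity fun χ => ENNReal.ofReal ((-F) χ)).real B := by
    rw [measureReal_def, measureReal_def, withDensity_apply _ hB, withDensity_apply _ hB,
      integral_eq_lintegral_pos_part_sub_lintegral_neg_part hF.integrableOn]
    rfl
  have hmB := congrArg (fun m : Measure (PontryaginDual A) => m.real B) hm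
  simp only [measureReal_add_apply (measure_ne_top _ _) (measure_ne_top _ _)] at hmB
  rw [hv μ F hF, hv ν G hG]
  linarith

/-- Complex densities with the same Fourier transform have the same integrals over every
measurable set. -/
theorem setIntegral_eq_of_integral_eval_mul_eq {μ ν : Measure (PontryaginDual A)}
    {F G : PontryaginDual A → ℂ} (hF : Integrable F μ) (hG : Integrable G ν)
    (h : ∀ a : A, ∫ χ, evalHom a χ * F χ ∂μ = ∫ χ, evalHom a χ * G χ ∂ν)
    {B : Set (PontryaginDual A)} (hB : MeasurableSet B) :
    ∫ χ in B, F χ ∂μ = ∫ χ in B, G χ ∂ν := by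
  have hconj (μ : Measure (PontryaginDual A)) (F : PontryaginDual A → ℂ) (a : A) :
      ∫ χ, evalHom a χ * conj (F χ) ∂μ = conj (∫ χ, evalHom a⁻¹ χ * F χ ∂μ) := by
    rw [← integral_conj]
    simp only [_root_.map_mul, evalHom_inv, Complex.conj_conj]
  have hre (μ : Measure (PontryaginDual A)) (F : PontryaginDual A → ℂ) (hF : Integrable F μ)
      (a : A) : ∫ χ, evalHom a χ * ((F χ).re : ℂ) ∂μ =
        (∫ χ, evalHom a χ * F χ ∂μ + ∫ χ, evalHom a χ * conj (F χ) ∂μ) / 2 := by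
    rw [← integral_add (integrable_eval_mul hF a) (integrable_eval_mul (F := fun χ => conj (F χ))
        ((LinearIsometryEquiv.integrable_comp_iff Complex.conjLIE).2 hF) a),
      ← integral_div]
    refine integral_congr_ae (.of_forall fun χ => ?_)
    simp only [Complex.re_eq_add_conj]
    ring
  have hreal (F G : PontryaginDual A → ℂ) (hF : Integrable F μ) (hG : Integrable G ν)
      (h : ∀ a : A, ∫ χ, evalHom a χ * F χ ∂μ = ∫ χ, evalHom a χ * G χ ∂ν) :
      (∫ χ in B, F χ ∂μ).re = (∫ χ in B, G χ ∂ν).re := by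
    have hre' := setIntegral_eq_of_integral_eval_ofReal_mul_eq hF.re hG.re (fun a => by
      have h1 := hre μ F hF a
      have h2 := hre ν G hG a
      rw [hconj, h, h] at h1
      rw [hconj] at h2
      exact h1.trans h2.symm) hB
    have h1 := integral_re (𝕜 := ℂ) (hF.integrableOn (s := B))
    have h2 := integral_re (𝕜 := ℂ) (hG.integrableOn (s := B))
    exact h1.symm.trans (hre'.trans h2)
  refine Complex.ext (hreal F G hF hG h) ?_
  have := hreal (fun χ => Complex.I * F χ) (fun χ => Complex.I * G χ) (hF.const_mul _)
    (hG.const_mul _) (fun a => by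
      simp only [mul_left_comm _ Complex.I, integral_const_mul, h a])
  simpa [integral_const_mul] using this

end PontryaginDual

section Model

open PontryaginDual (evalHom evalHom_inv norm_evalHom setIntegral_eq_of_integral_eval_mul_eq)

/-- The function `χ ↦ χ(a⁻¹)` as an element of `L²(σ)`. -/
noncomputable def charLp (σ : Measure (PontryaginDual A)) [IsFiniteMeasure σ] (a : A) :
    Lp ℂ 2 σ :=
  BoundedContinuousFunction.toLp 2 σ ℂ (evalHom a⁻¹)

theorem inner_charLp (σ : Measure (PontryaginDual A)) [IsFiniteMeasure σ] (a : A)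
    (f : Lp ℂ 2 σ) : inner ℂ (charLp σ a) f = ∫ χ, evalHom a χ * f χ ∂σ := by
  rw [L2.inner_def]
  refine integral_congr_ae ?_
  filter_upwards [BoundedContinuousFunction.coeFn_toLp (p := 2) (𝕜 := ℂ) σ (evalHom a⁻¹)] with χ hχ
  rw [charLp, hχ, RCLike.inner_apply, evalHom_inv, Complex.conj_conj, mul_comm]

theorem integrable_conj_mul {X : Type*} [MeasurableSpace X] {σ : Measure X} (f g : Lp ℂ 2 σ) :
    Integrable (fun χ => conj (f χ) * g χ) σ := by
  simpa only [RCLike.inner_apply, mul_comm] using L2.integrable_inner (𝕜 := ℂ) f g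

theorem eq_zero_of_forall_inner_charLp_eq_zero {σ : Measure (PontryaginDual A)}
    [IsFiniteMeasure σ] {f : Lp ℂ 2 σ} (h : ∀ a : A, inner ℂ (charLp σ a) f = 0) : f = 0 := by
  have hf : Integrable f σ := (Lp.memLp f).integrable (by norm_num)
  refine (Lp.eq_zero_iff_ae_eq_zero).2
    (hf.ae_eq_zero_of_forall_setIntegral_eq_zero fun B hB _ => ?_)
  rw [setIntegral_eq_of_integral_eval_mul_eq hf (integrable_zero _ ℂ σ) (fun a => ?_) hB]
  · simp
  · rw [← inner_charLp, h a]
    simp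

theorem ext_inner_charLp {σ : Measure (PontryaginDual A)} [IsFiniteMeasure σ] {f g : Lp ℂ 2 σ}
    (h : ∀ a : A, inner ℂ (charLp σ a) f = inner ℂ (charLp σ a) g) : f = g :=
  sub_eq_zero.1 (eq_zero_of_forall_inner_charLp_eq_zero fun a => by
    rw [inner_sub_right, h a, sub_self])

theorem denseRange_linearCombination_charLp (σ : Measure (PontryaginDual A))
    [IsFiniteMeasure σ] : DenseRange (Finsupp.linearCombination ℂ (charLp σ)) := by
  have h : (LinearMap.range (Finsupp.linearCombination ℂ (charLp σ))).topologicalClosure = ⊤ := by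
    rw [Submodule.topologicalClosure_eq_top_iff, Submodule.eq_bot_iff]
    intro f hf
    refine eq_zero_of_forall_inner_charLp_eq_zero fun a => ?_
    exact (Submodule.mem_orthogonal _ _).1 hf _ ⟨Finsupp.single a 1, by simp⟩
  exact (Submodule.dense_iff_topologicalClosure_eq_top).2 h

theorem unitary_mul_apply (U : A →* (H ≃ₗᵢ[ℂ] H)) (a b : A) (y : H) :
    U a (U b y) = U (a * b) y := by
  rw [map_mul]
  rfl

theorem inner_unitary_comm (U : A →* (H ≃ₗᵢ[ℂ] H)) (a : A) (y z : H) :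
    inner ℂ (U a y) z = inner ℂ y (U a⁻¹ z) := by
  rw [← LinearIsometryEquiv.inner_map_map (U a) y, unitary_mul_apply, mul_inv_cancel, map_one]
  rfl

theorem IsSpectralMeasure.inner_charLp_charLp {U : A →* (H ≃ₗᵢ[ℂ] H)} {x : H}
    {σ : Measure (PontryaginDual A)} [IsFiniteMeasure σ] (hσ : IsSpectralMeasure U x σ) (a b : A) :
    inner ℂ (charLp σ a) (charLp σ b) = inner ℂ (U a x) (U b x) := by
  have h : inner ℂ (U (b⁻¹ * a) x) x = ∫ χ, evalHom (b⁻¹ * a) χ ∂σ := hσ _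
  rw [← inv_inv b, ← inner_unitary_comm, unitary_mul_apply, inv_inv, h, inner_charLp]
  refine integral_congr_ae ?_
  filter_upwards [BoundedContinuousFunction.coeFn_toLp (p := 2) (𝕜 := ℂ) σ (evalHom b⁻¹)] with χ hχ
  rw [charLp, hχ, map_mul, BoundedContinuousFunction.mul_apply, mul_comm]

/-- The cyclic space of a vector is modelled on `L²` of its spectral measure. -/
theorem IsSpectralMeasure.exists_linearIsometry {U : A →* (H ≃ₗᵢ[ℂ] H)} {x : H}
    {σ : Measure (PontryaginDual A)} [IsFiniteMeasure σ] (hσ : IsSpectralMeasure U x σ) :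
    ∃ V : Lp ℂ 2 σ →ₗᵢ[ℂ] H, ∀ a, V (charLp σ a) = U a x := by
  set p := Finsupp.linearCombination ℂ (charLp σ)
  set q := Finsupp.linearCombination ℂ fun a => U a x
  have hdense : DenseRange p := denseRange_linearCombination_charLp σ
  have hnorm (c : A →₀ ℂ) : ‖q c‖ = ‖p c‖ := by
    have : inner ℂ (q c) (q c) = inner ℂ (p c) (p c) := by
      simp only [p, q, Finsupp.linearCombination_apply, Finsupp.sum, sum_inner, inner_sum,
        inner_smul_left, inner_smul_right, hσ.inner_charLp_charLp]
    rw [@norm_eq_sqrt_re_inner ℂ, this, ← @norm_eq_sqrt_re_inner ℂ]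
  have hext (c : A →₀ ℂ) : q.extendOfNorm p (p c) = q c :=
    LinearMap.extendOfNorm_eq hdense ⟨1, fun c => by rw [hnorm, one_mul]⟩ c
  refine ⟨⟨(q.extendOfNorm p).toLinearMap, fun f => ?_⟩, fun a => ?_⟩
  · refine hdense.induction (P := fun f => ‖q.extendOfNorm p f‖ = ‖f‖) ?_
      (isClosed_eq (by fun_prop) (by fun_prop)) f
    rintro _ ⟨c, rfl⟩
    rw [hext, hnorm]
  · have := hext (Finsupp.single a 1)
    simpa [p, q] using this

/-- If `V : L²(σ) → H` intertwines translations with `U`, then so does its adjoint. -/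
theorem inner_unitary_apply_map {U : A →* (H ≃ₗᵢ[ℂ] H)} {x : H}
    {σ : Measure (PontryaginDual A)} [IsFiniteMeasure σ] {V : Lp ℂ 2 σ →ₗᵢ[ℂ] H}
    (hV : ∀ a, V (charLp σ a) = U a x) (a : A) (y : H) (h : Lp ℂ 2 σ) :
    inner ℂ (U a y) (V h) =
      ∫ χ, evalHom a χ * (conj (V.toContinuousLinearMap.adjoint y χ) * h χ) ∂σ := by
  set W := V.toContinuousLinearMap.adjoint
  have hWleft (z : H) (g : Lp ℂ 2 σ) : inner ℂ (W z) g = inner ℂ z (V g) :=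
    ContinuousLinearMap.adjoint_inner_left _ _ _
  have hWright (z : H) (g : Lp ℂ 2 σ) : inner ℂ g (W z) = inner ℂ (V g) z :=
    ContinuousLinearMap.adjoint_inner_right _ _ _
  have hmem : MemLp (fun χ => evalHom a⁻¹ χ * W y χ) 2 σ :=
    (Lp.memLp (W y)).of_le
      ((evalHom a⁻¹).continuous.aestronglyMeasurable.mul (Lp.aestronglyMeasurable (W y)))
      (.of_forall fun χ => by rw [norm_mul, norm_evalHom, one_mul])
  have hW : W (U a y) = hmem.toLp := by
    refine ext_inner_charLp fun b => ?_
    have hab : inner ℂ (U b x) (U a y) = inner ℂ (U (a⁻¹ * b) x) y := by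
      rw [← unitary_mul_apply, inner_unitary_comm U a⁻¹, inv_inv]
    rw [hWright, hV, hab, ← hV, ← hWright, inner_charLp, inner_charLp]
    refine integral_congr_ae ?_
    filter_upwards [hmem.coeFn_toLp] with χ hχ
    rw [hχ, map_mul, BoundedContinuousFunction.mul_apply]
    ring
  rw [← hWleft, hW, L2.inner_def]
  refine integral_congr_ae ?_
  filter_upwards [hmem.coeFn_toLp] with χ hχ
  rw [hχ, RCLike.inner_apply, map_mul, evalHom_inv, Complex.conj_conj]
  ring

theorem inner_unitary_map_apply {U : A →* (H ≃ₗᵢ[ℂ] H)} {x : H}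
    {σ : Measure (PontryaginDual A)} [IsFiniteMeasure σ] {V : Lp ℂ 2 σ →ₗᵢ[ℂ] H}
    (hV : ∀ a, V (charLp σ a) = U a x) (a : A) (g : Lp ℂ 2 σ) (z : H) :
    inner ℂ (U a (V g)) z =
      ∫ χ, evalHom a χ * (conj (g χ) * V.toContinuousLinearMap.adjoint z χ) ∂σ := by
  rw [inner_unitary_comm, ← inner_conj_symm, inner_unitary_apply_map hV, ← integral_conj]
  refine integral_congr_ae (.of_forall fun χ => ?_)
  simp only [map_mul, evalHom_inv, Complex.conj_conj]
  ring

theorem IsSpectralDecomposition.exists_linearIsometry {U : A →* (H ≃ₗᵢ[ℂ] H)} {x : ℕ → H}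
    {σ : ℕ → Measure (PontryaginDual A)} [∀ i, IsFiniteMeasure (σ i)]
    (hdec : IsSpectralDecomposition U x σ) :
    ∃ V : ∀ i, Lp ℂ 2 (σ i) →ₗᵢ[ℂ] H, (∀ i a, V i (charLp (σ i) a) = U a (x i)) ∧
      (∀ i j, i ≠ j → ∀ f g, inner ℂ (V i f) (V j g) = 0) ∧
      ∀ z, (∀ i f, inner ℂ (V i f) z = 0) → z = 0 := by
  choose V hV using fun i => (hdec.spectral i).exists_linearIsometry
  refine ⟨V, hV, fun i j hij f g => ?_, fun z hz => ?_⟩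
  · have hmem (i : ℕ) (f : Lp ℂ 2 (σ i)) :
        V i f ∈ (cyclicSpace U (x i)).topologicalClosure := by
      refine (denseRange_linearCombination_charLp (σ i)).induction
        (P := fun f => V i f ∈ (cyclicSpace U (x i)).topologicalClosure) ?_
        ((Submodule.isClosed_topologicalClosure _).preimage (V i).continuous) f
      rintro _ ⟨c, rfl⟩
      refine Submodule.le_topologicalClosure _ ?_
      rw [Finsupp.linearCombination_apply, Finsupp.sum, map_sum]
      refine Submodule.sum_mem _ fun a _ => ?_
      rw [map_smul, hV]
      exact Submodule.smul_mem _ _ (Submodule.subset_span ⟨a, rfl⟩)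
    have hle : cyclicSpace U (x j) ≤ (cyclicSpace U (x i))ᗮ := fun w hw =>
      (Submodule.mem_orthogonal _ _).2 fun v hv => hdec.orthogonal i j hij v hv w hw
    have hg : V j g ∈ (cyclicSpace U (x i)).topologicalClosureᗮ := by
      rw [Submodule.orthogonal_closure]
      exact Submodule.topologicalClosure_minimal _ hle (Submodule.isClosed_orthogonal _) (hmem j g)
    exact (Submodule.mem_orthogonal _ _).1 hg _ (hmem i f)
  · have hz' : z ∈ (⨆ i, cyclicSpace U (x i))ᗮ := by
      rw [← Submodule.iInf_orthogonal, Submodule.mem_iInf]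
      intro i
      rw [cyclicSpace, Submodule.mem_orthogonal]
      intro u hu
      induction hu using Submodule.span_induction with
      | mem u hu =>
        obtain ⟨a, rfl⟩ := hu
        change inner ℂ (U a (x i)) z = 0
        rw [← hV]
        exact hz _ _
      | zero => exact inner_zero_left _
      | add u v _ _ hu hv => rw [inner_add_left, hu, hv, add_zero]
      | smul c u _ hu => rw [inner_smul_left, hu, mul_zero]
    rw [(Submodule.topologicalClosure_eq_top_iff).1 hdec.total] at hz'
    exact (Submodule.mem_bot ℂ).1 hz'

end Model

section Gram

open PontryaginDual (evalHom setIntegral_eq_of_integral_eval_mul_eq)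

theorem adjoint_map_apply_self {σ : Measure (PontryaginDual A)} (V : Lp ℂ 2 σ →ₗᵢ[ℂ] H)
    (f : Lp ℂ 2 σ) : V.toContinuousLinearMap.adjoint (V f) = f :=
  ext_inner_left ℂ fun g => by
    rw [ContinuousLinearMap.adjoint_inner_right]
    exact V.inner_map_map g f

theorem adjoint_map_apply_of_orthogonal {σ τ : Measure (PontryaginDual A)}
    {V : Lp ℂ 2 σ →ₗᵢ[ℂ] H} {W : Lp ℂ 2 τ →ₗᵢ[ℂ] H} (h : ∀ f g, inner ℂ (V f) (W g) = 0)
    (f : Lp ℂ 2 τ) : V.toContinuousLinearMap.adjoint (W f) = 0 :=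
  ext_inner_left ℂ fun g => by
    rw [ContinuousLinearMap.adjoint_inner_right, inner_zero_right]
    exact h g f

/-- The part of one cyclic space living over `B` is orthogonal to every cyclic space whose spectral
measure does not charge `B`. -/
theorem adjoint_map_indicator_eq_zero {U : A →* (H ≃ₗᵢ[ℂ] H)} {x x' : H}
    {σ τ : Measure (PontryaginDual A)} [IsFiniteMeasure σ] [IsFiniteMeasure τ]
    {V : Lp ℂ 2 σ →ₗᵢ[ℂ] H} {W : Lp ℂ 2 τ →ₗᵢ[ℂ] H}
    (hV : ∀ a, V (charLp σ a) = U a x) (hW : ∀ a, W (charLp τ a) = U a x')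
    {B : Set (PontryaginDual A)} (hB : MeasurableSet B) (hτ : τ B = 0) :
    W.toContinuousLinearMap.adjoint (V (indicatorConstLp 2 hB (measure_ne_top σ B) 1)) = 0 := by
  set e := indicatorConstLp 2 hB (measure_ne_top σ B) (1 : ℂ) with he
  set f := W.toContinuousLinearMap.adjoint (V e)
  have h := setIntegral_eq_of_integral_eval_mul_eq
    (integrable_conj_mul f f)
    (integrable_conj_mul e (V.toContinuousLinearMap.adjoint (W f)))
    (fun a => (inner_unitary_apply_map hW a (V e) f).symm.trans
      (inner_unitary_map_apply hV a e (W f))) hB.compl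
  have hr : τ.restrict Bᶜ = τ := by
    rw [Measure.restrict_eq_self_of_ae_mem]
    exact measure_eq_zero_iff_ae_notMem.1 hτ
  rw [hr, setIntegral_eq_zero_of_ae_eq_zero] at h
  · refine inner_self_eq_zero.1 (Eq.trans ?_ h)
    rw [L2.inner_def]
    exact integral_congr_ae (.of_forall fun χ => by simp only [RCLike.inner_apply, mul_comm])
  · filter_upwards [indicatorConstLp_coeFn_notMem (p := 2) (hs := hB) (hμs := measure_ne_top σ B)
      (c := (1 : ℂ))] with χ hχ hχB
    rw [he, hχ hχB, map_zero, zero_mul]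

/-- The Gram function of two sections of the field of Hilbert spaces
`⊕_{j < n} L²(τ_j)`, with density taken with respect to `μ`. -/
noncomputable def gram (μ : Measure (PontryaginDual A)) (τ : ℕ → Measure (PontryaginDual A))
    (n : ℕ) (f g : ∀ j, Lp ℂ 2 (τ j)) (χ : PontryaginDual A) : ℂ :=
  ∑ j : Fin n, ((τ j).rnDeriv μ χ).toReal • (conj (f j χ) * g j χ)

variable {μ : Measure (PontryaginDual A)} {τ : ℕ → Measure (PontryaginDual A)}
  [IsFiniteMeasure μ] [∀ j, IsFiniteMeasure (τ j)] {n : ℕ}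

theorem integrable_gram (hτ : ∀ j, τ j ≪ μ) (f g : ∀ j, Lp ℂ 2 (τ j)) :
    Integrable (gram μ τ n f g) μ :=
  integrable_finsetSum _ fun j _ =>
    (integrable_rnDeriv_smul_iff (hτ j)).2 (integrable_conj_mul (f j) (g j))

theorem measurable_gram (f g : ∀ j, Lp ℂ 2 (τ j)) : Measurable (gram μ τ n f g) := by
  have hf (f : ∀ j, Lp ℂ 2 (τ j)) (j : ℕ) : Measurable (f j) :=
    (Lp.stronglyMeasurable (f j)).measurable
  exact Finset.measurable_sum _ fun j _ =>
    (Measure.measurable_rnDeriv _ _).ennreal_toReal.smul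
      ((Complex.continuous_conj.measurable.comp (hf f j)).mul (hf g j))

theorem integral_eval_mul_gram (hτ : ∀ j, τ j ≪ μ) (f g : ∀ j, Lp ℂ 2 (τ j)) (a : A) :
    ∫ χ, evalHom a χ * gram μ τ n f g χ ∂μ =
      ∑ j : Fin n, ∫ χ, evalHom a χ * (conj (f j χ) * g j χ) ∂τ j := by
  have hint (j : ℕ) : Integrable (fun χ => evalHom a χ * (conj (f j χ) * g j χ)) (τ j) :=
    PontryaginDual.integrable_eval_mul (integrable_conj_mul (f j) (g j)) a
  simp_rw [gram, Finset.mul_sum, mul_smul_comm]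
  rw [integral_finsetSum _ fun (j : Fin n) _ => (integrable_rnDeriv_smul_iff (hτ j)).2 (hint j)]
  exact Finset.sum_congr rfl fun j _ => integral_rnDeriv_smul (hτ j)

/-- `n + 1` vectors in a space of dimension `n` cannot be nonzero and pairwise orthogonal. -/
theorem exists_gram_apply_diag_eq_zero (f : ℕ → ∀ j, Lp ℂ 2 (τ j)) (χ : PontryaginDual A)
    (h : ∀ i k, i ≠ k → gram μ τ n (f i) (f k) χ = 0) :
    ∃ i ≤ n, gram μ τ n (f i) (f i) χ = 0 := by
  by_contra! hne
  let M : Matrix (Fin (n + 1)) (Fin n) ℂ := .of fun i j => conj (f i j χ)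
  let N : Matrix (Fin n) (Fin (n + 1)) ℂ :=
    .of fun j k => ((τ j).rnDeriv μ χ).toReal * f k j χ
  have hMN : M * N = .diagonal fun i : Fin (n + 1) => gram μ τ n (f i) (f i) χ := by
    ext i k
    have hik : (M * N) i k = gram μ τ n (f i) (f k) χ := by
      rw [Matrix.mul_apply, gram]
      refine Finset.sum_congr rfl fun j _ => ?_
      simp only [M, N, Matrix.of_apply, Complex.real_smul]
      ring
    rw [hik, Matrix.diagonal_apply]
    split_ifs with hk
    · rw [hk]
    · exact h _ _ (Fin.val_ne_iff.2 hk)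
  have hrank := (Matrix.rank_mul_le_left M N).trans M.rank_le_width
  rw [hMN, Matrix.rank_of_isUnit] at hrank
  · simp at hrank
  · rw [Matrix.isUnit_diagonal, Pi.isUnit_iff]
    exact fun i => (hne i (Nat.lt_succ_iff.1 i.2)).isUnit

end Gram

theorem IsSpectralDecomposition.absolutelyContinuous_of_le {U : A →* (H ≃ₗᵢ[ℂ] H)} {x : ℕ → H}
    {σ : ℕ → Measure (PontryaginDual A)} (hdec : IsSpectralDecomposition U x σ) {i j : ℕ}
    (hij : i ≤ j) : σ j ≪ σ i := by
  induction j, hij using Nat.le_induction with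
  | base => exact .rfl
  | succ j _ ih => exact (hdec.chain j).trans ih

open PontryaginDual (setIntegral_eq_of_integral_eval_mul_eq) in
/-- The spectral measures of one spectral decomposition are dominated by those of any other: over a
set not charged by `σ' n`, the space `H` has at most `n` dimensions in the second decomposition. -/
theorem IsSpectralDecomposition.absolutelyContinuous {U : A →* (H ≃ₗᵢ[ℂ] H)} {x x' : ℕ → H}
    {σ σ' : ℕ → Measure (PontryaginDual A)} (hdec : IsSpectralDecomposition U x σ)
    (hdec' : IsSpectralDecomposition U x' σ') (n : ℕ) : σ n ≪ σ' n := by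
  have := hdec.finite
  have := hdec'.finite
  obtain ⟨V, hV, hVorth, -⟩ := hdec.exists_linearIsometry
  obtain ⟨W, hW, hWorth, hWtotal⟩ := hdec'.exists_linearIsometry
  refine .mk fun B hB hB0 => ?_
  set e : ∀ i, Lp ℂ 2 (σ i) := fun i => indicatorConstLp 2 hB (measure_ne_top (σ i) B) 1 with he
  set f : ∀ _ j : ℕ, Lp ℂ 2 (σ' j) := fun i j => (W j).toContinuousLinearMap.adjoint (V i (e i))

  have hWf (i j : ℕ) (g : Lp ℂ 2 (σ' j)) : inner ℂ (W j g) (V i (e i)) = inner ℂ g (f i j) :=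
    (ContinuousLinearMap.adjoint_inner_right (W j).toContinuousLinearMap g _).symm
  have hsum (i : ℕ) : V i (e i) = ∑ j : Fin n, W j (f i j) := by
    refine sub_eq_zero.1 (hWtotal _ fun j g => ?_)
    rw [inner_sub_right, inner_sum, hWf, sub_eq_zero,
      Fin.sum_univ_eq_sum_range (fun k => inner ℂ (W j g) (W k (f i k))) n]
    by_cases hj : j < n
    · rw [Finset.sum_eq_single_of_mem j (Finset.mem_range.2 hj)
        fun k _ hk => hWorth j k hk.symm _ _, (W j).inner_map_map]
    · have hj0 : f i j = 0 := adjoint_map_indicator_eq_zero (hV i) (hW j) hB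
        (hdec'.absolutelyContinuous_of_le (not_lt.1 hj) hB0)
      rw [hj0, inner_zero_right, Finset.sum_eq_zero]
      intro k hk
      exact hWorth j k (by rintro rfl; exact hj (Finset.mem_range.1 hk)) _ _
  have hac (j : ℕ) : σ' j ≪ σ' 0 := hdec'.absolutelyContinuous_of_le j.zero_le
  set G : ℕ → ℕ → PontryaginDual A → ℂ := fun i k => gram (σ' 0) σ' n (f i) (f k)
  have hGint (i k : ℕ) : Integrable (G i k) (σ' 0) := integrable_gram hac _ _
  have hGset (i k : ℕ) (C : Set (PontryaginDual A)) (hC : MeasurableSet C) :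
      ∫ χ in C, G i k χ ∂σ' 0 = ∫ χ in C,
        conj (e i χ) * (V i).toContinuousLinearMap.adjoint (V k (e k)) χ ∂σ i := by
    refine setIntegral_eq_of_integral_eval_mul_eq (hGint i k) (integrable_conj_mul _ _)
      (fun a => ?_) hC
    rw [← inner_unitary_map_apply (hV i), integral_eval_mul_gram hac, hsum k, inner_sum]
    exact Finset.sum_congr rfl fun j _ => (inner_unitary_apply_map (hW j) _ _ _).symm
  have hGoff (i k : ℕ) (hik : i ≠ k) : ∀ᵐ χ ∂σ' 0, G i k χ = 0 := by
    refine (hGint i k).ae_eq_zero_of_forall_setIntegral_eq_zero fun C hC _ => ?_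
    rw [hGset i k C hC, adjoint_map_apply_of_orthogonal (hVorth i k hik)]
    refine integral_eq_zero_of_ae (ae_restrict_of_ae ?_)
    filter_upwards [Lp.coeFn_zero ℂ 2 (σ i)] with χ hχ
    simp only [hχ, Pi.zero_apply, mul_zero]
  have hGdiag (i : ℕ) (C : Set (PontryaginDual A)) (hC : MeasurableSet C)
      (h : ∫ χ in C, G i i χ ∂σ' 0 = 0) : σ i (C ∩ B) = 0 := by
    have hind : (fun χ => conj (e i χ) * e i χ) =ᵐ[σ i] B.indicator fun _ => 1 := by
      filter_upwards [indicatorConstLp_coeFn (p := 2) (hs := hB)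
        (hμs := measure_ne_top (σ i) B) (c := (1 : ℂ))] with χ hχ
      rw [he, hχ]
      by_cases hχB : χ ∈ B <;> simp [hχB]
    rw [hGset i i C hC, adjoint_map_apply_self, integral_congr_ae (ae_restrict_of_ae hind),
      setIntegral_indicator hB, setIntegral_const, smul_eq_zero_iff_left one_ne_zero] at h
    exact (measureReal_eq_zero_iff).1 h
  by_contra hBn
  have : (ae ((σ n).restrict B)).NeBot := by
    rw [ae_neBot, Ne, Measure.restrict_eq_zero]
    exact hBn
  have hrestrict : (σ n).restrict B ≪ σ' 0 := by
    refine .mk fun C hC hC0 => ?_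
    rw [Measure.restrict_apply hC]
    exact hGdiag n C hC (setIntegral_measure_zero _ hC0)
  have hoff : ∀ᵐ χ ∂(σ n).restrict B, ∀ i k, i ≠ k → G i k χ = 0 := by
    simp only [ae_all_iff, Filter.eventually_imp_distrib_left]
    exact fun i k hik => hrestrict.ae_le (hGoff i k hik)
  have hdiag : ∀ᵐ χ ∂(σ n).restrict B, ∀ i ≤ n, G i i χ ≠ 0 := by
    simp only [ae_all_iff, Filter.eventually_imp_distrib_left]
    intro i hi
    have hC : MeasurableSet {χ | G i i χ = 0} :=
      measurable_gram (f i) (f i) (measurableSet_singleton 0)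
    rw [ae_iff]
    simp only [not_not]
    rw [Measure.restrict_apply hC]
    exact hdec.absolutelyContinuous_of_le hi
      (hGdiag i _ hC (setIntegral_eq_zero_of_forall_eq_zero fun χ hχ => hχ))
  obtain ⟨χ, hχoff, hχdiag⟩ := (hoff.and hdiag).exists
  obtain ⟨i, hi, hi0⟩ := exists_gram_apply_diag_eq_zero f χ hχoff
  exact hχdiag i hi hi0

/-- **Spectral Theorem (uniqueness of the spectral decomposition).**  If
`H = ⊕ᵢ A(xᵢ) = ⊕ᵢ A(xᵢ')` are two spectral decompositions of a continuous unitary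
representation `U` of a locally compact second countable Abelian group `A` on a separable
Hilbert space `H`, then `σ_{xᵢ}` and `σ_{xᵢ'}` are equivalent measures for every `i`. -/
theorem spectral_decomposition_unique [TopologicalSpace.SeparableSpace H]
    (U : A →* (H ≃ₗᵢ[ℂ] H)) (hU : ∀ x : H, Continuous fun a : A => U a x)
    (x x' : ℕ → H) (σ σ' : ℕ → Measure (PontryaginDual A))
    (hdec : IsSpectralDecomposition U x σ) (hdec' : IsSpectralDecomposition U x' σ') :
    ∀ i, σ i ≪ σ' i ∧ σ' i ≪ σ i := by
  exact fun n => ⟨hdec.absolutelyContinuous hdec' n, hdec'.absolutelyContinuous hdec n⟩
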